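/- Let p > 3 be a prime and let a be a rational number whose denominator is coprime to p. Then Σ_{k=0}^{p-1} C(-a,k)·C(a-1,k)·H_k ≡ (-1)^{⟨a⟩_p - 1} · 2 · Σ_{k=1}^{⟨a⟩_p - 1} 1/(a-k) (mod p²). -/

import Mathlib

open Finset

/-- Generalized binomial coefficient `C(a,k) = a(a-1)⋯(a-k+1)/k!` for a rational `a`. -/
noncomputable def gchoose (a : ℚ) (k : ℕ) : ℚ :=
  (∏ j ∈ Finset.range k, (a - j)) / (Nat.factorial k : ℚ)

/-- The harmonic number `H_k = ∑_{j=1}^k 1/j`. -/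
def harm (k : ℕ) : ℚ := ∑ j ∈ Finset.range k, (1 : ℚ) / (j + 1)

/-- The second-order harmonic number `H_k^{(2)} = ∑_{j=1}^k 1/j²`. -/
def harm2 (k : ℕ) : ℚ := ∑ j ∈ Finset.range k, (1 : ℚ) / (j + 1) ^ 2

/-- `x ≡ y (mod p^m)` for rationals: the p-adic valuation of `x - y` is at least `m`
(with the convention that the valuation of `0` is `+∞`). -/
def CongrMod (p m : ℕ) (x y : ℚ) : Prop :=
  x = y ∨ (m : ℤ) ≤ padicValRat p (x - y)

/-- The Bernoulli polynomial `B_n` evaluated at a rational `x`. -/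
noncomputable def bpoly (n : ℕ) (x : ℚ) : ℚ := (Polynomial.bernoulli n).eval x

/-- The Euler polynomial `E_n` evaluated at a rational `x`, via
`E_n(x) = (2/(n+1))·(B_{n+1}(x) − 2^{n+1}·B_{n+1}(x/2))`. -/
noncomputable def epoly (n : ℕ) (x : ℚ) : ℚ :=
  (2 / (n + 1 : ℚ)) * (bpoly (n + 1) x - 2 ^ (n + 1) * bpoly (n + 1) (x / 2))

/-- The Euler number `E_n = 2^n · E_n(1/2)`. -/
noncomputable def eulerNum (n : ℕ) : ℚ := 2 ^ n * epoly n (1 / 2)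

/-- The rationals whose `p`-adic norm is at most `p ^ (-m)`. -/
def padicBall (p : ℕ) [Fact p.Prime] (m : ℕ) : AddSubgroup ℚ where
  carrier := {x | padicNorm p x ≤ (p : ℚ) ^ (-(m : ℤ))}
  add_mem' hx hy := padicNorm.nonarchimedean.trans (max_le hx hy)
  zero_mem' := by
    simp only [Set.mem_ofPred_eq, padicNorm.zero]
    positivity
  neg_mem' hx := by simpa only [Set.mem_ofPred_eq, padicNorm.neg] using hx

section PadicBall

variable {p : ℕ} [hp : Fact p.Prime]

theorem mem_padicBall {m : ℕ} {x : ℚ} :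
    x ∈ padicBall p m ↔ padicNorm p x ≤ (p : ℚ) ^ (-(m : ℤ)) := Iff.rfl

theorem congrMod_iff_sub_mem_padicBall {m : ℕ} {x y : ℚ} :
    CongrMod p m x y ↔ x - y ∈ padicBall p m := by
  rw [mem_padicBall, CongrMod]
  by_cases h : x - y = 0
  · rw [h, padicNorm.zero]
    exact iff_of_true (Or.inl (sub_eq_zero.mp h)) (by positivity)
  · rw [padicNorm.eq_zpow_of_nonzero h,
      zpow_le_zpow_iff_right₀ (by exact_mod_cast hp.out.one_lt), neg_le_neg_iff]
    simp [sub_eq_zero.not.mp h]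

theorem padicBall_mono {m n : ℕ} (h : n ≤ m) : padicBall p m ≤ padicBall p n := fun x hx => by
  rw [mem_padicBall] at *
  refine hx.trans (zpow_le_zpow_right₀ (by exact_mod_cast hp.out.one_lt.le) ?_)
  omega

theorem mul_mem_padicBall {m n : ℕ} {x y : ℚ} (hx : x ∈ padicBall p m) (hy : y ∈ padicBall p n) :
    x * y ∈ padicBall p (m + n) := by
  rw [mem_padicBall] at *
  have hp0 : (p : ℚ) ≠ 0 := by exact_mod_cast hp.out.ne_zero
  rw [padicNorm.mul, Nat.cast_add, neg_add, zpow_add₀ hp0]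
  exact mul_le_mul hx hy (padicNorm.nonneg _) (by positivity)

theorem mul_mem_padicBall_left {m : ℕ} {x y : ℚ} (hx : x ∈ padicBall p m)
    (hy : y ∈ padicBall p 0) : x * y ∈ padicBall p m := by
  simpa only [add_zero] using mul_mem_padicBall hx hy

theorem mul_mem_padicBall_right {m : ℕ} {x y : ℚ} (hx : x ∈ padicBall p 0)
    (hy : y ∈ padicBall p m) : x * y ∈ padicBall p m := by
  rw [mul_comm]
  exact mul_mem_padicBall_left hy hx

theorem mul_mem_padicBall_zero {x y : ℚ} (hx : x ∈ padicBall p 0) (hy : y ∈ padicBall p 0) :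
    x * y ∈ padicBall p 0 := mul_mem_padicBall_left hx hy

theorem mul_mem_padicBall_two {x y : ℚ} (hx : x ∈ padicBall p 1) (hy : y ∈ padicBall p 1) :
    x * y ∈ padicBall p 2 := mul_mem_padicBall (m := 1) (n := 1) hx hy

theorem intCast_mem_padicBall (z : ℤ) : (z : ℚ) ∈ padicBall p 0 := by
  simpa [mem_padicBall] using padicNorm.of_int z

theorem natCast_mem_padicBall (n : ℕ) : (n : ℚ) ∈ padicBall p 0 := by
  exact_mod_cast intCast_mem_padicBall (p := p) n

theorem one_mem_padicBall : (1 : ℚ) ∈ padicBall p 0 := by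
  exact_mod_cast natCast_mem_padicBall (p := p) 1

theorem two_mem_padicBall : (2 : ℚ) ∈ padicBall p 0 := by
  exact_mod_cast natCast_mem_padicBall (p := p) 2

theorem intCast_mem_padicBall_one {z : ℤ} (h : (p : ℤ) ∣ z) : (z : ℚ) ∈ padicBall p 1 :=
  padicNorm.dvd_iff_norm_le.mp (by simpa using h)

theorem prime_mem_padicBall : (p : ℚ) ∈ padicBall p 1 := by
  exact_mod_cast intCast_mem_padicBall_one (p := p) dvd_rfl

theorem one_div_natCast_mem_padicBall {k : ℕ} (h0 : 0 < k) (hk : k < p) :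
    1 / (k : ℚ) ∈ padicBall p 0 := by
  rw [mem_padicBall, padicNorm.div,
    (padicNorm.nat_eq_one_iff k).mpr (Nat.not_dvd_of_pos_of_lt h0 hk)]
  simp

theorem one_div_succ_mem_padicBall {k : ℕ} (hk : k + 1 < p) :
    1 / ((k : ℚ) + 1) ∈ padicBall p 0 := by
  exact_mod_cast one_div_natCast_mem_padicBall (p := p) k.succ_pos hk

theorem padicNorm_eq_one_of_sub_mem_padicBall {a : ℚ} {r : ℕ} (h0 : 0 < r) (hr : r < p)
    (ha : a - r ∈ padicBall p 1) : padicNorm p a = 1 := by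
  have hnr : padicNorm p r = 1 :=
    (padicNorm.nat_eq_one_iff r).mpr (Nat.not_dvd_of_pos_of_lt h0 hr)
  have hlt : padicNorm p (a - r) < 1 := by
    refine (mem_padicBall.mp ha).trans_lt ?_
    have : (1 : ℚ) < p := by exact_mod_cast hp.out.one_lt
    simpa using inv_lt_one_of_one_lt₀ this
  have := padicNorm.add_eq_max_of_ne (p := p) (q := a - r) (r := r) (by rw [hnr]; exact hlt.ne)
  rwa [sub_add_cancel, hnr, max_eq_right hlt.le] at this

theorem mem_padicBall_zero_of_sub {a : ℚ} {r : ℕ} (ha : a - r ∈ padicBall p 1) :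
    a ∈ padicBall p 0 := by
  simpa using add_mem (padicBall_mono zero_le_one ha) (natCast_mem_padicBall r)

theorem prod_mem_padicBall {ι : Type*} {s : Finset ι} {f : ι → ℚ}
    (h : ∀ i ∈ s, f i ∈ padicBall p 0) : ∏ i ∈ s, f i ∈ padicBall p 0 :=
  Finset.prod_induction f (· ∈ padicBall p 0) (fun _ _ => mul_mem_padicBall_zero) one_mem_padicBall h

theorem prod_mem_padicBall_of_mem {ι : Type*} [DecidableEq ι] {s : Finset ι} {f : ι → ℚ} {m : ℕ}
    (h : ∀ i ∈ s, f i ∈ padicBall p 0) {i : ι} (hi : i ∈ s) (hfi : f i ∈ padicBall p m) :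
    ∏ i ∈ s, f i ∈ padicBall p m := by
  rw [← Finset.mul_prod_erase s f hi]
  exact mul_mem_padicBall_left hfi
    (prod_mem_padicBall fun j hj => h j (Finset.mem_of_mem_erase hj))

/-! ### Power sums of reciprocals modulo `p` -/

theorem sum_range_succ_pow_zmod_eq_zero {m : ℕ} (h0 : 0 < m) (hm : m < p - 1) :
    ∑ k ∈ range (p - 1), ((k : ZMod p) + 1) ^ m = 0 := by
  have hcard : Fintype.card (ZMod p) = p := ZMod.card p
  rw [← FiniteField.sum_pow_lt_card_sub_one (ZMod p) m (by rwa [hcard])]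
  have hsum : ∑ k ∈ range p, (k : ZMod p) ^ m = ∑ x : ZMod p, x ^ m := by
    refine Finset.sum_nbij (fun k => (k : ZMod p)) (fun _ _ => mem_univ _) ?_ ?_ (fun _ _ => rfl)
    · intro i hi j hj hij
      simp only [coe_range, Set.mem_Iio] at hi hj
      have := (ZMod.natCast_eq_natCast_iff' i j p).mp hij
      rwa [Nat.mod_eq_of_lt hi, Nat.mod_eq_of_lt hj] at this
    · intro x _
      exact ⟨x.val, by simpa using x.val_lt, ZMod.natCast_zmod_val x⟩
  rw [← hsum]
  obtain ⟨n, hn⟩ : ∃ n, p = n + 1 := ⟨p - 1, by have := hp.out.pos; omega⟩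
  rw [show range p = range (n + 1) by rw [hn], Finset.sum_range_succ', show p - 1 = n by omega]
  simp [h0.ne']

theorem sum_one_div_succ_pow_mem_padicBall {m : ℕ} (h0 : 0 < m) (hm : m < p - 1) :
    ∑ k ∈ range (p - 1), 1 / ((k : ℚ) + 1) ^ m ∈ padicBall p 1 := by
  have hpow : ∑ k ∈ range (p - 1), ((k : ℚ) + 1) ^ (p - 1 - m) ∈ padicBall p 1 := by
    have := sum_range_succ_pow_zmod_eq_zero (p := p) (m := p - 1 - m) (by omega) (by omega)
    have hdvd : (p : ℤ) ∣ ∑ k ∈ range (p - 1), ((k : ℤ) + 1) ^ (p - 1 - m) := by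
      rw [← ZMod.intCast_zmod_eq_zero_iff_dvd]
      exact_mod_cast this
    exact_mod_cast intCast_mem_padicBall_one hdvd
  rw [← sub_add_cancel (∑ k ∈ range (p - 1), 1 / ((k : ℚ) + 1) ^ m)
    (∑ k ∈ range (p - 1), ((k : ℚ) + 1) ^ (p - 1 - m)), ← Finset.sum_sub_distrib]
  refine add_mem (sum_mem fun k hk => ?_) hpow
  have hk' : k + 1 < p := by have := mem_range.mp hk; omega
  have hfermat : (p : ℤ) ∣ 1 - ((k : ℤ) + 1) ^ (p - 1) := by
    rw [← ZMod.intCast_zmod_eq_zero_iff_dvd]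
    have hne : ((k + 1 : ℕ) : ZMod p) ≠ 0 := by
      rw [Ne, ZMod.natCast_eq_zero_iff]
      exact Nat.not_dvd_of_pos_of_lt k.succ_pos hk'
    have := ZMod.pow_card_sub_one_eq_one hne
    push_cast at this ⊢
    rw [this, sub_self]
  have hk0 : (k : ℚ) + 1 ≠ 0 := by positivity
  have hsplit : ((k : ℚ) + 1) ^ (p - 1) = (k + 1) ^ m * (k + 1) ^ (p - 1 - m) := by
    rw [← pow_add]
    congr 1
    omega
  have heq : 1 / ((k : ℚ) + 1) ^ m - (k + 1) ^ (p - 1 - m) =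
      ((1 - ((k : ℤ) + 1) ^ (p - 1) : ℤ) : ℚ) * ∏ _i ∈ range m, 1 / ((k : ℚ) + 1) := by
    push_cast
    rw [hsplit, Finset.prod_const, card_range, one_div_pow]
    field_simp
  rw [heq]
  exact mul_mem_padicBall_left (intCast_mem_padicBall_one hfermat)
    (prod_mem_padicBall fun _ _ => one_div_succ_mem_padicBall hk')

theorem harm_mem_padicBall_zero {n : ℕ} (hn : n < p) : harm n ∈ padicBall p 0 :=
  sum_mem fun k hk => one_div_succ_mem_padicBall (by have := mem_range.mp hk; omega)

end PadicBall

theorem harm_succ (n : ℕ) : harm (n + 1) = harm n + 1 / (n + 1) := by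
  rw [harm, Finset.sum_range_succ, ← harm]

theorem sum_harm_succ_div (n : ℕ) :
    ∑ k ∈ range n, harm (k + 1) / (k + 1) =
      1 / 2 * (harm n ^ 2 + ∑ k ∈ range n, 1 / ((k : ℚ) + 1) ^ 2) := by
  induction n with
  | zero => simp [harm]
  | succ n ih =>
    rw [Finset.sum_range_succ, ih, Finset.sum_range_succ, harm_succ]
    field_simp
    ring

/-! ### The products entering the recurrences -/

/-- The product of the factors `1 - a² / j²` over `1 ≤ j ≤ n`. -/
def sineProd (a : ℚ) (n : ℕ) : ℚ := ∏ j ∈ range n, (1 - a ^ 2 / ((j : ℚ) + 1) ^ 2)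

/-- The product of the factors `1 - a (a + 1) / (j (j + 1))` over `1 ≤ j ≤ n`. -/
def cosineProd (a : ℚ) (n : ℕ) : ℚ :=
  ∏ j ∈ range n, (1 - a * (a + 1) / (((j : ℚ) + 1) * (j + 2)))

theorem sineProd_succ (a : ℚ) (n : ℕ) :
    sineProd a (n + 1) = sineProd a n * (1 - a ^ 2 / ((n : ℚ) + 1) ^ 2) :=
  Finset.prod_range_succ _ _

theorem cosineProd_succ (a : ℚ) (n : ℕ) :
    cosineProd a (n + 1) = cosineProd a n * (1 - a * (a + 1) / (((n : ℚ) + 1) * (n + 2))) :=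
  Finset.prod_range_succ _ _

theorem sineProd_eq_mul (a : ℚ) (n : ℕ) :
    sineProd a n =
      (∏ j ∈ range n, (1 - a * (1 / ((j : ℚ) + 1)))) *
        ∏ j ∈ range n, (1 + a * (1 / ((j : ℚ) + 1))) := by
  rw [sineProd, ← Finset.prod_mul_distrib]
  refine Finset.prod_congr rfl fun j _ => ?_
  field_simp
  ring

theorem cosineProd_eq_mul (a : ℚ) (n : ℕ) :
    cosineProd a n =
      (∏ j ∈ range n, (1 - a * (1 / ((j : ℚ) + 1)))) *
        ∏ j ∈ range n, (1 + a * (1 / (((j + 1 : ℕ) : ℚ) + 1))) := by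
  rw [cosineProd, ← Finset.prod_mul_distrib]
  refine Finset.prod_congr rfl fun j _ => ?_
  push_cast
  field_simp
  ring

theorem gchoose_succ (a : ℚ) (k : ℕ) : gchoose a (k + 1) = gchoose a k * (a - k) / (k + 1) := by
  have : (k.factorial : ℚ) ≠ 0 := by exact_mod_cast k.factorial_ne_zero
  rw [gchoose, gchoose, Finset.prod_range_succ, Nat.factorial_succ]
  push_cast
  field_simp

/-- The product of binomial coefficients `C(-a, k) C(a - 1, k)`. -/
noncomputable def pairChoose (a : ℚ) (k : ℕ) : ℚ := gchoose (-a) k * gchoose (a - 1) k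

theorem pairChoose_zero (a : ℚ) : pairChoose a 0 = 1 := by simp [pairChoose, gchoose]

theorem pairChoose_one_add (a : ℚ) (k : ℕ) : pairChoose (1 + a) k = pairChoose (-a) k := by
  rw [pairChoose, pairChoose, mul_comm, neg_neg, show 1 + a - 1 = a by ring,
    show -(1 + a) = -a - 1 by ring]

theorem pairChoose_succ (a : ℚ) (k : ℕ) :
    pairChoose a (k + 1) = pairChoose a k * ((-a - k) * (a - 1 - k)) / (k + 1) ^ 2 := by
  rw [pairChoose, pairChoose, gchoose_succ, gchoose_succ]
  field_simp

theorem pairChoose_mul_add (a : ℚ) (k : ℕ) : pairChoose a k * (a + k) = a * sineProd a k := by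
  induction k with
  | zero => simp [pairChoose_zero, sineProd]
  | succ k ih =>
    rw [pairChoose_succ, sineProd_succ, ← mul_assoc a, ← ih]
    push_cast
    field_simp
    ring

theorem pairChoose_add_one_mul_sub (a : ℚ) (k : ℕ) :
    pairChoose (a + 1) k * (a - k) = a * sineProd a k := by
  induction k with
  | zero => simp [pairChoose_zero, sineProd]
  | succ k ih =>
    rw [pairChoose_succ, sineProd_succ, ← mul_assoc a, ← ih]
    push_cast
    field_simp
    ring

theorem pairChoose_succ_eq (a : ℚ) (k : ℕ) :
    pairChoose a (k + 1) = -(a * sineProd a k * (a - 1 - k)) / (k + 1) ^ 2 := by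
  rw [pairChoose_succ, ← pairChoose_mul_add]
  ring

theorem pairChoose_succ_add (a : ℚ) (k : ℕ) :
    pairChoose a (k + 1) + pairChoose (a + 1) (k + 1) =
      2 * (sineProd a (k + 1) - sineProd a k) := by
  have h : pairChoose (a + 1) (k + 1) = -(a * sineProd a k * (a + 1 + k)) / (k + 1) ^ 2 := by
    rw [pairChoose_succ, ← pairChoose_add_one_mul_sub]
    ring
  rw [h, pairChoose_succ_eq, sineProd_succ]
  field_simp
  ring

theorem sum_sineProd_sub_mul_harm (a : ℚ) (n : ℕ) :
    ∑ k ∈ range n, (sineProd a (k + 1) - sineProd a k) * harm (k + 1) =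
      sineProd a n * harm n - ∑ k ∈ range n, sineProd a k / (k + 1) := by
  induction n with
  | zero => simp [harm]
  | succ n ih =>
    rw [Finset.sum_range_succ, ih, Finset.sum_range_succ, harm_succ]
    ring

theorem sum_pairChoose_mul_harm_succ (a : ℚ) (n : ℕ) :
    ∑ k ∈ range (n + 1), pairChoose a k * harm k =
      ∑ k ∈ range n, pairChoose a (k + 1) * harm (k + 1) := by
  rw [Finset.sum_range_succ']
  simp [harm]

theorem sum_pairChoose_mul_harm_add (a : ℚ) (n : ℕ) :
    ∑ k ∈ range (n + 1), pairChoose a k * harm k +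
        ∑ k ∈ range (n + 1), pairChoose (a + 1) k * harm k =
      2 * (sineProd a n * harm n - ∑ k ∈ range n, sineProd a k / (k + 1)) := by
  rw [sum_pairChoose_mul_harm_succ, sum_pairChoose_mul_harm_succ, ← sum_sineProd_sub_mul_harm,
    ← Finset.sum_add_distrib, Finset.mul_sum]
  refine Finset.sum_congr rfl fun k _ => ?_
  rw [← add_mul, pairChoose_succ_add, mul_assoc]

theorem sineProd_succ_eq_cosineProd (a : ℚ) (k : ℕ) :
    sineProd a (k + 1) = -((a + 1) * cosineProd a k * (a - k - 1)) / (k + 1) := by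
  induction k with
  | zero => simp [sineProd, cosineProd]; ring
  | succ k ih =>
    rw [sineProd_succ, ih, cosineProd_succ]
    push_cast
    field_simp
    ring

theorem sineProd_add_one_succ_eq_cosineProd (a : ℚ) (k : ℕ) :
    sineProd (a + 1) (k + 1) = -(a * cosineProd a k * (a + k + 2)) / (k + 1) := by
  induction k with
  | zero => simp [sineProd, cosineProd]; ring
  | succ k ih =>
    rw [sineProd_succ, ih, cosineProd_succ]
    push_cast
    field_simp
    ring

theorem sum_sineProd_div_add (a : ℚ) (n : ℕ) :
    a * ∑ k ∈ range (n + 1), sineProd a k / (k + 1) +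
        (a + 1) * ∑ k ∈ range (n + 1), sineProd (a + 1) k / (k + 1) =
      (2 * a + 1) * cosineProd a n := by
  induction n with
  | zero => simp [sineProd, cosineProd]; ring
  | succ n ih =>
    rw [Finset.sum_range_succ, Finset.sum_range_succ _ (n + 1), mul_add, mul_add, add_add_add_comm,
      ih, sineProd_succ_eq_cosineProd, sineProd_add_one_succ_eq_cosineProd, cosineProd_succ]
    push_cast
    field_simp
    ring

/-! ### Congruences for the products -/

section Congruences

variable {p : ℕ} [hp : Fact p.Prime]

theorem one_sub_mul_one_div_mem_padicBall {a : ℚ} (ha : a ∈ padicBall p 0) {j : ℕ}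
    (hj : j + 1 < p) : 1 - a * (1 / ((j : ℚ) + 1)) ∈ padicBall p 0 :=
  sub_mem one_mem_padicBall (mul_mem_padicBall_left ha (one_div_succ_mem_padicBall hj))

theorem one_add_mul_one_div_mem_padicBall {a : ℚ} (ha : a ∈ padicBall p 0) {j : ℕ}
    (hj : j + 1 < p) : 1 + a * (1 / ((j : ℚ) + 1)) ∈ padicBall p 0 :=
  add_mem one_mem_padicBall (mul_mem_padicBall_left ha (one_div_succ_mem_padicBall hj))

theorem sineProd_mem_padicBall_zero {a : ℚ} (ha : a ∈ padicBall p 0) {n : ℕ} (hn : n < p) :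
    sineProd a n ∈ padicBall p 0 := by
  rw [sineProd_eq_mul]
  refine mul_mem_padicBall_left (prod_mem_padicBall fun j hj => ?_)
    (prod_mem_padicBall fun j hj => ?_) <;> rw [mem_range] at hj
  · exact one_sub_mul_one_div_mem_padicBall ha (by omega)
  · exact one_add_mul_one_div_mem_padicBall ha (by omega)

theorem one_sub_mul_one_div_mem_padicBall_one {a : ℚ} {j : ℕ} (hj : j + 1 < p)
    (ha : a - ((j + 1 : ℕ) : ℚ) ∈ padicBall p 1) :
    1 - a * (1 / ((j : ℚ) + 1)) ∈ padicBall p 1 := by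
  rw [show 1 - a * (1 / ((j : ℚ) + 1)) = -((a - ((j + 1 : ℕ) : ℚ)) * (1 / ((j : ℚ) + 1))) by
    push_cast
    field_simp
    ring]
  exact neg_mem (mul_mem_padicBall_left ha (one_div_succ_mem_padicBall hj))

theorem one_add_mul_one_div_mem_padicBall_one {a : ℚ} {r j : ℕ} (hj : r + (j + 1) = p)
    (hr : 0 < r) (ha : a - r ∈ padicBall p 1) :
    1 + a * (1 / ((j : ℚ) + 1)) ∈ padicBall p 1 := by
  have hcast : (p : ℚ) = r + (j + 1) := by exact_mod_cast hj.symm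
  rw [show 1 + a * (1 / ((j : ℚ) + 1)) = (a - r + p) * (1 / ((j : ℚ) + 1)) by
    rw [hcast]
    field_simp
    ring]
  exact mul_mem_padicBall_left (add_mem ha prime_mem_padicBall)
    (one_div_succ_mem_padicBall (by omega))

theorem prod_one_sub_mul_one_div_mem_padicBall_one {a : ℚ} {r n : ℕ} (hr : 0 < r) (hrn : r ≤ n)
    (hn : n < p) (ha : a - r ∈ padicBall p 1) :
    ∏ j ∈ range n, (1 - a * (1 / ((j : ℚ) + 1))) ∈ padicBall p 1 := by
  obtain ⟨i, rfl⟩ : ∃ i, r = i + 1 := ⟨r - 1, by omega⟩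
  refine prod_mem_padicBall_of_mem (fun j hj => ?_) (mem_range.mpr (by omega : i < n))
    (one_sub_mul_one_div_mem_padicBall_one (by omega) ha)
  have := mem_range.mp hj
  exact one_sub_mul_one_div_mem_padicBall (mem_padicBall_zero_of_sub ha) (by omega)

theorem sineProd_mem_padicBall_two {a : ℚ} {r : ℕ} (hr : 0 < r) (hrp : r < p)
    (ha : a - r ∈ padicBall p 1) : sineProd a (p - 1) ∈ padicBall p 2 := by
  rw [sineProd_eq_mul]
  refine mul_mem_padicBall_two
    (prod_one_sub_mul_one_div_mem_padicBall_one hr (by omega) (by omega) ha) ?_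
  refine prod_mem_padicBall_of_mem (fun j hj => ?_)
    (mem_range.mpr (by omega : p - r - 1 < p - 1))
    (one_add_mul_one_div_mem_padicBall_one (by omega) hr ha)
  have := mem_range.mp hj
  exact one_add_mul_one_div_mem_padicBall (mem_padicBall_zero_of_sub ha) (by omega)

theorem cosineProd_mem_padicBall_two {a : ℚ} {r : ℕ} (hr : 0 < r) (hrp : r + 1 < p)
    (ha : a - r ∈ padicBall p 1) : cosineProd a (p - 2) ∈ padicBall p 2 := by
  rw [cosineProd_eq_mul]
  refine mul_mem_padicBall_two
    (prod_one_sub_mul_one_div_mem_padicBall_one hr (by omega) (by omega) ha) ?_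
  refine prod_mem_padicBall_of_mem (fun j hj => ?_)
    (mem_range.mpr (by omega : p - r - 2 < p - 2))
    (one_add_mul_one_div_mem_padicBall_one (by omega) hr ha)
  have := mem_range.mp hj
  exact one_add_mul_one_div_mem_padicBall (mem_padicBall_zero_of_sub ha) (by omega)

theorem sineProd_sub_one_mem_padicBall {b : ℚ} (hb : b ∈ padicBall p 1) {n : ℕ} (hn : n < p) :
    sineProd b n - 1 ∈ padicBall p 2 := by
  induction n with
  | zero => simp [sineProd]
  | succ n ih =>
    rw [show sineProd b (n + 1) - 1 = sineProd b n - 1 -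
        b * b * (sineProd b n * (1 / ((n : ℚ) + 1) * (1 / ((n : ℚ) + 1)))) by
      rw [sineProd_succ]
      field_simp
      ring]
    have hinv := one_div_succ_mem_padicBall hn
    exact sub_mem (ih (by omega)) (mul_mem_padicBall_left (mul_mem_padicBall_two hb hb)
      (mul_mem_padicBall_left
        (sineProd_mem_padicBall_zero (padicBall_mono zero_le_one hb) (by omega))
        (mul_mem_padicBall_zero hinv hinv)))

theorem cosineProd_sub_mem_padicBall {b : ℚ} (hb : b ∈ padicBall p 1) {n : ℕ} (hn : n + 1 < p) :
    cosineProd b n - (1 - b * (n * (1 / ((n : ℚ) + 1)))) ∈ padicBall p 2 := by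
  induction n with
  | zero => simp [cosineProd]
  | succ n ih =>
    have hinv := one_div_succ_mem_padicBall (p := p) (k := n) (by omega)
    have hinv' := one_div_succ_mem_padicBall hn
    have hb0 := padicBall_mono zero_le_one hb
    set c := 1 / ((n : ℚ) + 1) with hc
    set d := 1 / (((n + 1 : ℕ) : ℚ) + 1) with hd
    rw [show cosineProd b (n + 1) - (1 - b * (((n + 1 : ℕ) : ℚ) * d)) =
        (cosineProd b n - (1 - b * (n * c))) * (1 - b * (b + 1) * (c * d)) -
          b * b * (c * d - (b + 1) * (n * c) * (c * d)) by
      rw [cosineProd_succ, hc, hd]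
      push_cast
      field_simp
      ring]
    have hb1 := add_mem hb0 one_mem_padicBall
    have hcd : c * d ∈ padicBall p 0 := mul_mem_padicBall_zero hinv hinv'
    refine sub_mem (mul_mem_padicBall_left (ih (by omega)) (sub_mem one_mem_padicBall ?_))
      (mul_mem_padicBall_left (mul_mem_padicBall_two hb hb) (sub_mem hcd ?_))
    · exact mul_mem_padicBall_zero (mul_mem_padicBall_zero hb0 hb1) hcd
    · exact mul_mem_padicBall_zero (mul_mem_padicBall_zero hb1
        (mul_mem_padicBall_zero (natCast_mem_padicBall n) hinv)) hcd

theorem harm_sub_one_mem_padicBall (hp3 : 3 < p) : harm (p - 1) ∈ padicBall p 1 := by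
  simpa [harm] using
    sum_one_div_succ_pow_mem_padicBall (p := p) (m := 1) one_pos (by omega)

theorem mul_sum_sineProd_div_mem_padicBall (hp3 : 3 < p) {b : ℚ} (hb : b ∈ padicBall p 1) :
    b * ∑ k ∈ range (p - 1), sineProd b k / (k + 1) ∈ padicBall p 2 := by
  refine mul_mem_padicBall_two hb ?_
  rw [show ∑ k ∈ range (p - 1), sineProd b k / ((k : ℚ) + 1) =
      ∑ k ∈ range (p - 1), (sineProd b k - 1) * (1 / ((k : ℚ) + 1)) + harm (p - 1) by
    rw [harm, ← Finset.sum_add_distrib]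
    exact Finset.sum_congr rfl fun k _ => by ring]
  refine add_mem (sum_mem fun k hk => ?_) (harm_sub_one_mem_padicBall hp3)
  rw [mem_range] at hk
  exact mul_mem_padicBall_left
    (padicBall_mono one_le_two (sineProd_sub_one_mem_padicBall hb (by omega)))
    (one_div_succ_mem_padicBall (by omega))

theorem two_mul_add_one_mul_cosineProd_sub_one_mem_padicBall (hp3 : 3 < p) {b : ℚ}
    (hb : b ∈ padicBall p 1) : (2 * b + 1) * cosineProd b (p - 2) - 1 ∈ padicBall p 2 := by
  have hcos := cosineProd_sub_mem_padicBall hb (n := p - 2) (by omega)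
  have hinv := one_div_succ_mem_padicBall (p := p) (k := p - 2) (by omega)
  have hb0 := padicBall_mono zero_le_one hb
  have hcast : (p : ℚ) = ((p - 2 : ℕ) : ℚ) + 2 := by
    rw [Nat.cast_sub (by omega)]
    simp
  set n := p - 2 with hn
  set c := 1 / ((n : ℚ) + 1) with hc
  rw [show (2 * b + 1) * cosineProd b n - 1 =
      (cosineProd b n - (1 - b * (n * c))) * (2 * b + 1) + b * p * c - b * b * (2 * (n * c)) by
    rw [hcast, hc]
    field_simp
    ring]
  refine sub_mem (add_mem (mul_mem_padicBall_left hcos ?_)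
    (mul_mem_padicBall_left (mul_mem_padicBall_two hb prime_mem_padicBall) hinv))
    (mul_mem_padicBall_left (mul_mem_padicBall_two hb hb) ?_)
  · exact add_mem (mul_mem_padicBall_zero two_mem_padicBall hb0) one_mem_padicBall
  · exact mul_mem_padicBall_zero two_mem_padicBall
      (mul_mem_padicBall_zero (natCast_mem_padicBall n) hinv)

theorem mul_sum_sineProd_div_sub_mem_padicBall (hp3 : 3 < p) (r : ℕ) (hr : r + 1 < p) {a : ℚ}
    (ha : a - ((r + 1 : ℕ) : ℚ) ∈ padicBall p 1) :
    a * ∑ k ∈ range (p - 1), sineProd a k / (k + 1) - (-1) ^ r ∈ padicBall p 2 := by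
  have hrec (b : ℚ) := sum_sineProd_div_add b (p - 2)
  simp only [show p - 2 + 1 = p - 1 by omega] at hrec
  induction r generalizing a with
  | zero =>
    obtain ⟨b, rfl⟩ : ∃ b, a = b + 1 := ⟨a - 1, by ring⟩
    have hb : b ∈ padicBall p 1 := by simpa using ha
    rw [eq_sub_of_add_eq' (hrec b), pow_zero, sub_right_comm]
    exact sub_mem (two_mul_add_one_mul_cosineProd_sub_one_mem_padicBall hp3 hb)
      (mul_sum_sineProd_div_mem_padicBall hp3 hb)
  | succ r ih =>
    obtain ⟨b, rfl⟩ : ∃ b, a = b + 1 := ⟨a - 1, by ring⟩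
    have hb : b - ((r + 1 : ℕ) : ℚ) ∈ padicBall p 1 := by
      convert ha using 1
      push_cast
      ring
    have hcos : (2 * b + 1) * cosineProd b (p - 2) ∈ padicBall p 2 := by
      refine mul_mem_padicBall_right (add_mem (mul_mem_padicBall_zero two_mem_padicBall ?_)
        one_mem_padicBall) (cosineProd_mem_padicBall_two r.succ_pos (by omega) hb)
      exact mem_padicBall_zero_of_sub hb
    convert sub_mem hcos (ih (by omega) hb) using 1
    rw [eq_sub_of_add_eq' (hrec b)]
    ring

theorem sum_sineProd_div_sub_mem_padicBall (hp3 : 3 < p) (r : ℕ) (hr : r + 1 < p) {a : ℚ}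
    (ha : a - ((r + 1 : ℕ) : ℚ) ∈ padicBall p 1) :
    ∑ k ∈ range (p - 1), sineProd a k / (k + 1) - (-1) ^ r * (1 / a) ∈ padicBall p 2 := by
  have hnorm := padicNorm_eq_one_of_sub_mem_padicBall r.succ_pos hr ha
  have hinv : 1 / a ∈ padicBall p 0 := by
    rw [mem_padicBall, padicNorm.div, hnorm]
    simp
  have ha0 : a ≠ 0 := by
    rintro rfl
    simp at hnorm
  convert mul_mem_padicBall_left (mul_sum_sineProd_div_sub_mem_padicBall hp3 r hr ha) hinv using 1
  field_simp

theorem sum_pairChoose_mul_harm_mem_padicBall (hp3 : 3 < p) {b : ℚ} (hb : b ∈ padicBall p 1) :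
    ∑ k ∈ range p, pairChoose b k * harm k ∈ padicBall p 2 := by
  rw [show range p = range (p - 1 + 1) by congr 1; omega, sum_pairChoose_mul_harm_succ]
  have hb0 := padicBall_mono zero_le_one hb
  have hmain : ∑ k ∈ range (p - 1), harm (k + 1) / ((k : ℚ) + 1) ∈ padicBall p 1 := by
    rw [sum_harm_succ_div, sq]
    have hH := harm_sub_one_mem_padicBall hp3
    have hhalf : 1 / (2 : ℚ) ∈ padicBall p 0 := by
      exact_mod_cast one_div_natCast_mem_padicBall (p := p) two_pos (by omega)
    exact mul_mem_padicBall_right hhalf (add_mem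
      (mul_mem_padicBall_left hH (padicBall_mono zero_le_one hH))
      (sum_one_div_succ_pow_mem_padicBall two_pos (by omega)))
  rw [← sub_add_cancel (∑ k ∈ range (p - 1), pairChoose b (k + 1) * harm (k + 1))
    (b * ∑ k ∈ range (p - 1), harm (k + 1) / ((k : ℚ) + 1)), Finset.mul_sum,
    ← Finset.sum_sub_distrib, ← Finset.mul_sum]
  refine add_mem (sum_mem fun k hk => ?_) (mul_mem_padicBall_two hb hmain)
  rw [mem_range] at hk
  have hinv := one_div_succ_mem_padicBall (p := p) (k := k) (by omega)
  have hH := harm_mem_padicBall_zero (p := p) (n := k + 1) (by omega)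
  have hsine := sineProd_sub_one_mem_padicBall hb (n := k) (by omega)
  have hsine0 := sineProd_mem_padicBall_zero hb0 (n := k) (by omega)
  set c := 1 / ((k : ℚ) + 1) with hc
  rw [show pairChoose b (k + 1) * harm (k + 1) - b * (harm (k + 1) / ((k : ℚ) + 1)) =
      ((sineProd b k - 1) * (b * c) - b * b * (sineProd b k * (c * c))) * harm (k + 1) by
    rw [pairChoose_succ_eq, hc]
    field_simp
    ring]
  exact mul_mem_padicBall_left (sub_mem
    (mul_mem_padicBall_left hsine (mul_mem_padicBall_zero hb0 hinv))
    (mul_mem_padicBall_left (mul_mem_padicBall_two hb hb)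
      (mul_mem_padicBall_zero hsine0 (mul_mem_padicBall_zero hinv hinv)))) hH

theorem sum_pairChoose_mul_harm_sub_mem_padicBall (hp3 : 3 < p) (r : ℕ) (hr : r + 1 < p) {a : ℚ}
    (ha : a - ((r + 1 : ℕ) : ℚ) ∈ padicBall p 1) :
    ∑ k ∈ range p, pairChoose a k * harm k -
      (-1) ^ r * 2 * ∑ k ∈ Ico 1 (r + 1), 1 / (a - k) ∈ padicBall p 2 := by
  induction r generalizing a with
  | zero =>
    obtain ⟨b, rfl⟩ : ∃ b, a = 1 + b := ⟨a - 1, by ring⟩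
    have hb : b ∈ padicBall p 1 := by simpa using ha
    simpa [pairChoose_one_add] using sum_pairChoose_mul_harm_mem_padicBall hp3 (neg_mem hb)
  | succ r ih =>
    obtain ⟨b, rfl⟩ : ∃ b, a = b + 1 := ⟨a - 1, by ring⟩
    have hb : b - ((r + 1 : ℕ) : ℚ) ∈ padicBall p 1 := by
      convert ha using 1
      push_cast
      ring
    have hrec := sum_pairChoose_mul_harm_add b (p - 1)
    rw [show p - 1 + 1 = p by omega] at hrec
    have hsum : ∑ k ∈ Ico 1 (r + 1 + 1), 1 / (b + 1 - k) =
        1 / b + ∑ k ∈ Ico 1 (r + 1), 1 / (b - k) := by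
      rw [Finset.sum_eq_sum_Ico_succ_bot (by omega),
        ← Finset.sum_Ico_add' (fun k : ℕ => 1 / (b + 1 - (k : ℚ))) 1 (r + 1) 1]
      congr 1
      · simp
      · exact Finset.sum_congr rfl fun k _ => by
          push_cast
          rw [add_sub_add_right_eq_sub]
    have hsine : sineProd b (p - 1) * harm (p - 1) ∈ padicBall p 2 :=
      mul_mem_padicBall_left (sineProd_mem_padicBall_two r.succ_pos (by omega) hb)
        (harm_mem_padicBall_zero (by omega))
    have hR := sum_sineProd_div_sub_mem_padicBall hp3 r (by omega) hb
    have := sub_mem (mul_mem_padicBall_right two_mem_padicBall (sub_mem hsine hR))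
      (ih (by omega) hb)
    convert this using 1
    rw [hsum, eq_sub_of_add_eq' hrec]
    ring

end Congruences

theorem stmt_0 (p : ℕ) (hp : p.Prime) (hp3 : 3 < p) (a : ℚ) (ha : ¬ (p ∣ a.den))
    (r : ℕ) (hr : r < p) (har : CongrMod p 1 a r) :
    CongrMod p 2
      (∑ k ∈ Finset.range p, gchoose (-a) k * gchoose (a - 1) k * harm k)
      ((-1 : ℚ) ^ (r + 1) * 2 * ∑ k ∈ Finset.Ico 1 r, 1 / (a - k)) := by
  have : Fact p.Prime := ⟨hp⟩
  rw [congrMod_iff_sub_mem_padicBall] at har ⊢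
  change ∑ k ∈ range p, pairChoose a k * harm k - _ ∈ _
  obtain _ | r := r
  · simpa using sum_pairChoose_mul_harm_mem_padicBall hp3 (by simpa using har)
  · simpa [pow_succ] using sum_pairChoose_mul_harm_sub_mem_padicBall hp3 r hr har
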